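/- Let μ be a measure on a measurable space 𝒳, θ : ℝᵈ × 𝒳 → ℝ differentiable in its first argument with ‖∇_α θ(α, x)‖ ≤ κ_θ(x) for all α and μ-a.e. x, and m : 𝒳 × ℝᵏ → ℝ twice continuously differentiable in its second argument with ‖∇_β m(x, β)‖ ≤ κ_m(x) for all β and μ-a.e. x, where x ↦ κ_θ(x)·κ_m(x) is μ-integrable. Let β* : ℝᵈ → ℝᵏ be differentiable with ∫ θ(α, x) ∇_β m(x, β*(α)) dμ(x) = 0 for all α, assume differentiation under the integral sign in α is valid, and assume the Hessian H(α) = ∫ θ(α, x) ∇²_β m(x, β*(α)) dμ(x) is symmetric and satisfies ⟨v, H(α) v⟩ ≥ γ‖v‖² for all v ∈ ℝᵏ and all α, for some γ > 0. Let h : ℝᵏ → ℝ be differentiable with ‖∇_β h(β)‖ ≤ κ_h for all β. Then the composite map f = h ∘ β* satisfies ‖∇_α f(α)‖ ≤ (1/γ) · (∫ κ_θ(x) κ_m(x) dμ(x)) · κ_h for all α; in particular f is Lipschitz on ℝᵈ with this constant. -/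

import Mathlib

open MeasureTheory
open scoped RealInnerProductSpace

/-- Step 1 of the proof of Proposition 3: under gradient bounds `‖∇_α θ(α,x)‖ ≤ κ_θ(x)`,
`‖∇_β m(x,β)‖ ≤ κ_m(x)` with `κ_θ·κ_m` integrable, validity of differentiation under the
integral sign for the first-order condition of the reweighted M-estimator `β*`, a
`γ`-strongly positive definite symmetric Hessian `H(α)`, and `‖∇h‖ ≤ κ_h`, the composite
objective `f = h ∘ β*` has gradient bounded by `(1/γ) · (∫ κ_θ κ_m dμ) · κ_h`; in
particular `f` is Lipschitz with this constant. -/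
theorem m_estimator_objective_lipschitz
    {𝒳 : Type*} [MeasurableSpace 𝒳] (μ : Measure 𝒳) (d k : ℕ)
    (θ : EuclideanSpace ℝ (Fin d) → 𝒳 → ℝ)
    (gradθ : EuclideanSpace ℝ (Fin d) → 𝒳 → EuclideanSpace ℝ (Fin d))
    (hθ : ∀ (α : EuclideanSpace ℝ (Fin d)) (x : 𝒳),
      HasGradientAt (fun a => θ a x) (gradθ α x) α)
    (κθ : 𝒳 → ℝ) (hκθ : ∀ᵐ x ∂μ, ∀ α, ‖gradθ α x‖ ≤ κθ x)
    (m : 𝒳 → EuclideanSpace ℝ (Fin k) → ℝ)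
    (gradm : 𝒳 → EuclideanSpace ℝ (Fin k) → EuclideanSpace ℝ (Fin k))
    (Hessm : 𝒳 → EuclideanSpace ℝ (Fin k) →
      (EuclideanSpace ℝ (Fin k) →L[ℝ] EuclideanSpace ℝ (Fin k)))
    (hm1 : ∀ (x : 𝒳) (β : EuclideanSpace ℝ (Fin k)), HasGradientAt (m x) (gradm x β) β)
    (hm2 : ∀ (x : 𝒳) (β : EuclideanSpace ℝ (Fin k)), HasFDerivAt (gradm x) (Hessm x β) β)
    (hm2cont : ∀ x : 𝒳, Continuous (Hessm x))
    (κm : 𝒳 → ℝ) (hκm : ∀ᵐ x ∂μ, ∀ β, ‖gradm x β‖ ≤ κm x)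
    (hκint : Integrable (fun x => κθ x * κm x) μ)
    (βstar : EuclideanSpace ℝ (Fin d) → EuclideanSpace ℝ (Fin k))
    (hβdiff : Differentiable ℝ βstar)
    (hFOC : ∀ α : EuclideanSpace ℝ (Fin d),
      (∫ x, θ α x • gradm x (βstar α) ∂μ) = 0)
    (H : EuclideanSpace ℝ (Fin d) →
      (EuclideanSpace ℝ (Fin k) →L[ℝ] EuclideanSpace ℝ (Fin k)))
    (hH : ∀ α, H α = ∫ x, θ α x • Hessm x (βstar α) ∂μ)
    (M : EuclideanSpace ℝ (Fin d) →
      (EuclideanSpace ℝ (Fin d) →L[ℝ] EuclideanSpace ℝ (Fin k)))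
    (hM : ∀ α, M α =
      ∫ x, (innerSL ℝ (gradθ α x)).smulRight (gradm x (βstar α)) ∂μ)
    (hDUI : ∀ α : EuclideanSpace ℝ (Fin d),
      HasFDerivAt
        (fun p : EuclideanSpace ℝ (Fin d) × EuclideanSpace ℝ (Fin k) =>
          ∫ x, θ p.1 x • gradm x p.2 ∂μ)
        ((M α).comp (ContinuousLinearMap.fst ℝ (EuclideanSpace ℝ (Fin d))
            (EuclideanSpace ℝ (Fin k))) +
          (H α).comp (ContinuousLinearMap.snd ℝ (EuclideanSpace ℝ (Fin d))
            (EuclideanSpace ℝ (Fin k))))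
        (α, βstar α))
    (γ : ℝ) (hγ : 0 < γ)
    (hsymm : ∀ (α : EuclideanSpace ℝ (Fin d)) (v w : EuclideanSpace ℝ (Fin k)),
      ⟪H α v, w⟫ = ⟪v, H α w⟫)
    (hposdef : ∀ (α : EuclideanSpace ℝ (Fin d)) (v : EuclideanSpace ℝ (Fin k)),
      γ * ‖v‖ ^ 2 ≤ ⟪v, H α v⟫)
    (h : EuclideanSpace ℝ (Fin k) → ℝ)
    (gradh : EuclideanSpace ℝ (Fin k) → EuclideanSpace ℝ (Fin k))
    (hhdiff : ∀ β, HasGradientAt h (gradh β) β)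
    (κh : ℝ) (hκh : ∀ β, ‖gradh β‖ ≤ κh) :
    (∀ α : EuclideanSpace ℝ (Fin d),
      ‖gradient (fun a => h (βstar a)) α‖ ≤ (1 / γ) * (∫ x, κθ x * κm x ∂μ) * κh) ∧
    (∀ α₁ α₂ : EuclideanSpace ℝ (Fin d),
      |h (βstar α₁) - h (βstar α₂)| ≤
        (1 / γ) * (∫ x, κθ x * κm x ∂μ) * κh * ‖α₁ - α₂‖) := by
  have hMb : ∀ α, ‖M α‖ ≤ ∫ x, κθ x * κm x ∂μ := by
    intro α
    rw [hM α]
    refine norm_integral_le_of_norm_le hκint ?_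
    filter_upwards [hκθ, hκm] with x h1 h2
    rw [ContinuousLinearMap.norm_smulRight_apply, innerSL_apply_norm]
    exact mul_le_mul (h1 α) (h2 _) (norm_nonneg _) ((norm_nonneg _).trans (h1 α))
  have hC : 0 ≤ ∫ x, κθ x * κm x ∂μ := (norm_nonneg _).trans (hMb 0)
  have hκ0 : 0 ≤ κh := (norm_nonneg _).trans (hκh 0)
  generalize (∫ x, κθ x * κm x ∂μ) = C at hMb hC ⊢
  have hD : ∀ α, ‖fderiv ℝ βstar α‖ ≤ (1 / γ) * C := by
    intro α
    refine ContinuousLinearMap.opNorm_le_bound _ (by positivity) fun u => ?_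
    have hb := (hβdiff α).hasFDerivAt
    have hc := (hDUI α).comp α ((hasFDerivAt_id α).prodMk hb)
    have h0 : HasFDerivAt ((fun p : EuclideanSpace ℝ (Fin d) × EuclideanSpace ℝ (Fin k) =>
          ∫ x, θ p.1 x • gradm x p.2 ∂μ) ∘ fun a => (id a, βstar a))
        (0 : EuclideanSpace ℝ (Fin d) →L[ℝ] EuclideanSpace ℝ (Fin k)) α := by
      have : ((fun p : EuclideanSpace ℝ (Fin d) × EuclideanSpace ℝ (Fin k) =>
          ∫ x, θ p.1 x • gradm x p.2 ∂μ) ∘ fun a => (id a, βstar a)) = fun _ => 0 := by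
        funext a
        exact hFOC a
      rw [this]
      exact hasFDerivAt_const _ _
    have he := congrArg (fun L => L u) (hc.unique h0)
    have he' : M α u + H α (fderiv ℝ βstar α u) = 0 := by simpa using he
    set v := fderiv ℝ βstar α u
    have h1 := hposdef α v
    rw [eq_neg_of_add_eq_zero_right he'] at h1
    have h2 : ⟪v, -(M α u)⟫ ≤ ‖v‖ * (C * ‖u‖) := by
      refine (real_inner_le_norm _ _).trans ?_
      rw [norm_neg]
      gcongr
      exact (M α).le_of_opNorm_le (hMb α) u
    have h3 : γ * ‖v‖ ≤ C * ‖u‖ := by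
      rcases (norm_nonneg v).eq_or_lt with hv | hv
      · rw [← hv]; simp; positivity
      · refine le_of_mul_le_mul_left ?_ hv
        nlinarith
    rw [one_div, mul_assoc, ← div_eq_inv_mul, le_div_iff₀ hγ]
    linarith
  have hf : ∀ α, HasFDerivAt (fun a => h (βstar a))
      ((InnerProductSpace.toDual ℝ _ (gradh (βstar α))).comp (fderiv ℝ βstar α)) α :=
    fun α => (hhdiff (βstar α)).hasFDerivAt.comp α (hβdiff α).hasFDerivAt
  have hfb : ∀ α, ‖fderiv ℝ (fun a => h (βstar a)) α‖ ≤ (1 / γ) * C * κh := by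
    intro α
    rw [(hf α).fderiv]
    refine (ContinuousLinearMap.opNorm_comp_le _ _).trans ?_
    rw [LinearIsometryEquiv.norm_map, mul_comm]
    exact mul_le_mul (hD α) (hκh _) (norm_nonneg _) (by positivity)
  refine ⟨fun α => ?_, fun α₁ α₂ => ?_⟩
  · unfold gradient
    rw [LinearIsometryEquiv.norm_map]
    exact hfb α
  · rw [← Real.norm_eq_abs]
    exact Convex.norm_image_sub_le_of_norm_fderiv_le (𝕜 := ℝ) (s := Set.univ)
      (fun x _ => (hf x).differentiableAt) (fun x _ => hfb x) convex_univ
      (Set.mem_univ α₂) (Set.mem_univ α₁)
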